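/- Let I = (−ρ, ρ) where 0 < ρ ≤ ∞, and let k and l be positive integers such that l = 1 if k = 1 and l ≤ 2k − 2 if k ≥ 2. For a function f : I → ℝ, the following are equivalent: (1) for every n ≥ k and every A ∈ S_n^{(k)}(I), the entrywise transform f[A] lies in S̄_n^{(l)}; (2) exactly one of the following holds: (a) f is constant, f(x) = d for all x ∈ I for some d ∈ ℝ; (b) l ≥ k and f is linear of the form f(x) = f(0) + c·x with c > 0, and moreover f(0) ≥ 0 if l = k. -/

import Mathlib

/-- The number of negative eigenvalues (with multiplicity) of a real symmetric
(Hermitian) matrix; junk value `0` if the matrix is not Hermitian. -/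
noncomputable def negEigCount {n : Type*} [Fintype n] [DecidableEq n]
    (A : Matrix n n ℝ) : ℕ :=
  if hA : A.IsHermitian then Nat.card {i // hA.eigenvalues i < 0} else 0

/-- Membership in the interval `(-ρ, ρ)` for `ρ : EReal` (so `ρ = ∞` is allowed). -/
def memI (ρ : EReal) (x : ℝ) : Prop := -ρ < (x : EReal) ∧ (x : EReal) < ρ

open Matrix

/-- A real symmetric matrix is diagonalised by a linear change of coordinates. -/
lemma exists_equiv_dotProduct_mulVec_eq {ι : Type*} [Fintype ι] [DecidableEq ι]
    {A : Matrix ι ι ℝ} (hA : A.IsHermitian) :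
    ∃ U : (ι → ℝ) ≃ₗ[ℝ] (ι → ℝ),
      ∀ x, x ⬝ᵥ A *ᵥ x = ∑ i, hA.eigenvalues i * U x i ^ 2 := by
  set W : Matrix ι ι ℝ := ↑hA.eigenvectorUnitary
  have h1 : Wᵀ * W = 1 := by
    have := Unitary.coe_star_mul_self hA.eigenvectorUnitary
    rwa [star_eq_conjTranspose, conjTranspose_eq_transpose_of_trivial] at this
  have h2 : W * Wᵀ = 1 := mul_eq_one_comm.mp h1
  refine ⟨LinearEquiv.ofLinearMap (mulVecLin Wᵀ) (mulVecLin W) ?_ ?_, fun x => ?_⟩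
  · rw [← mulVecLin_mul, h1, mulVecLin_one]
  · rw [← mulVecLin_mul, h2, mulVecLin_one]
  · have hs : A = W * diagonal hA.eigenvalues * Wᵀ := by
      have := hA.spectral_theorem
      simpa [Unitary.conjStarAlgAut_apply, star_eq_conjTranspose,
        conjTranspose_eq_transpose_of_trivial] using this
    have : x ⬝ᵥ A *ᵥ x = (Wᵀ *ᵥ x) ⬝ᵥ (diagonal hA.eigenvalues *ᵥ (Wᵀ *ᵥ x)) := by
      conv_lhs => rw [hs]
      rw [← mulVec_mulVec, ← mulVec_mulVec, dotProduct_mulVec, ← mulVec_transpose]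
    rw [this]
    simp only [dotProduct, mulVec_diagonal, LinearEquiv.coe_ofLinearMap, mulVecLin_apply]
    exact Finset.sum_congr rfl fun i _ => by ring

/-- A negative definite subspace has dimension at most `negEigCount`. -/
lemma finrank_le_negEigCount {ι V : Type*} [Fintype ι] [DecidableEq ι] [AddCommGroup V]
    [Module ℝ V] {A : Matrix ι ι ℝ} (hA : A.IsSymm) (T : V →ₗ[ℝ] (ι → ℝ))
    (hT : ∀ v, v ≠ 0 → T v ⬝ᵥ A *ᵥ T v < 0) :
    Module.finrank ℝ V ≤ negEigCount A := by
  have hH : A.IsHermitian := by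
    rw [IsHermitian, conjTranspose_eq_transpose_of_trivial]; exact hA
  obtain ⟨U, hU⟩ := exists_equiv_dotProduct_mulVec_eq hH
  rw [negEigCount, dif_pos hH]
  let S : V →ₗ[ℝ] ({i // hH.eigenvalues i < 0} → ℝ) :=
    LinearMap.funLeft ℝ ℝ Subtype.val ∘ₗ U.toLinearMap ∘ₗ T
  have hS : Function.Injective S := by
    rw [← LinearMap.ker_eq_bot, LinearMap.ker_eq_bot']
    intro v hv
    by_contra hne
    refine absurd (hT v hne) (not_lt.mpr ?_)
    rw [hU]
    refine Finset.sum_nonneg fun i _ => ?_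
    by_cases hi : hH.eigenvalues i < 0
    · have : U (T v) i = 0 := congrFun hv ⟨i, hi⟩
      simp [this]
    · exact mul_nonneg (not_lt.mp hi) (sq_nonneg _)
  simpa using LinearMap.finrank_le_finrank_of_injective hS

/-- `negEigCount` is at most the codimension of a subspace on which the form is nonnegative. -/
lemma negEigCount_le_finrank {ι V : Type*} [Fintype ι] [DecidableEq ι] [AddCommGroup V]
    [Module ℝ V] [Module.Finite ℝ V] {A : Matrix ι ι ℝ} (hA : A.IsSymm)
    (φ : (ι → ℝ) →ₗ[ℝ] V) (hφ : ∀ x, φ x = 0 → 0 ≤ x ⬝ᵥ A *ᵥ x) :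
    negEigCount A ≤ Module.finrank ℝ V := by
  have hH : A.IsHermitian := by
    rw [IsHermitian, conjTranspose_eq_transpose_of_trivial]; exact hA
  obtain ⟨U, hU⟩ := exists_equiv_dotProduct_mulVec_eq hH
  rw [negEigCount, dif_pos hH]
  let S : ({i // hH.eigenvalues i < 0} → ℝ) →ₗ[ℝ] V :=
    φ ∘ₗ U.symm.toLinearMap ∘ₗ Function.ExtendByZero.linearMap ℝ Subtype.val
  have hS : Function.Injective S := by
    rw [← LinearMap.ker_eq_bot, LinearMap.ker_eq_bot']
    intro c hc
    have h := hφ _ hc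
    rw [hU] at h
    simp only [LinearMap.coe_comp, LinearEquiv.coe_coe, Function.comp_apply,
      LinearEquiv.apply_symm_apply] at h
    have hterm : ∀ i ∈ Finset.univ, hH.eigenvalues i *
        (Function.ExtendByZero.linearMap ℝ Subtype.val c : ι → ℝ) i ^ 2 ≤ 0 := by
      intro i _
      by_cases hi : hH.eigenvalues i < 0
      · exact mul_nonpos_of_nonpos_of_nonneg hi.le (sq_nonneg _)
      · have : ¬ ∃ a : {i // hH.eigenvalues i < 0}, a.val = i := fun ⟨a, ha⟩ => hi (ha ▸ a.2)
        have h0 : (Function.ExtendByZero.linearMap ℝ Subtype.val c : ι → ℝ) i = 0 :=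
          Function.extend_apply' _ _ _ this
        simp [h0]
    have hz := (Finset.sum_eq_zero_iff_of_nonpos hterm).mp
      (le_antisymm (Finset.sum_nonpos hterm) h)
    ext j
    have hj := hz j.1 (Finset.mem_univ _)
    have he : (Function.ExtendByZero.linearMap ℝ Subtype.val c : ι → ℝ) j.1 = c j :=
      Subtype.val_injective.extend_apply _ _ _
    rw [he] at hj
    simpa [j.2.ne] using hj
  simpa using LinearMap.finrank_le_finrank_of_injective hS

/-- The form of a symmetric matrix is nonnegative on a subspace of codimension `negEigCount`. -/
lemma exists_nonneg_on_ker {ι : Type*} [Fintype ι] [DecidableEq ι]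
    {A : Matrix ι ι ℝ} (hA : A.IsSymm) :
    ∃ φ : (ι → ℝ) →ₗ[ℝ] (Fin (negEigCount A) → ℝ), ∀ x, φ x = 0 → 0 ≤ x ⬝ᵥ A *ᵥ x := by
  have hH : A.IsHermitian := by
    rw [IsHermitian, conjTranspose_eq_transpose_of_trivial]; exact hA
  obtain ⟨U, hU⟩ := exists_equiv_dotProduct_mulVec_eq hH
  rw [negEigCount, dif_pos hH]
  let e := Finite.equivFin {i // hH.eigenvalues i < 0}
  refine ⟨LinearMap.funLeft ℝ ℝ (Subtype.val ∘ e.symm) ∘ₗ U.toLinearMap, fun x hx => ?_⟩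
  rw [hU]
  refine Finset.sum_nonneg fun i _ => ?_
  by_cases hi : hH.eigenvalues i < 0
  · have : U x i = 0 := by simpa [LinearMap.funLeft] using congrFun hx (e ⟨i, hi⟩)
    simp [this]
  · exact mul_nonneg (not_lt.mp hi) (sq_nonneg _)

lemma negEigCount_le_card {ι : Type*} [Fintype ι] [DecidableEq ι]
    {A : Matrix ι ι ℝ} (hA : A.IsSymm) : negEigCount A ≤ Fintype.card ι := by
  simpa using negEigCount_le_finrank hA (LinearMap.id : (ι → ℝ) →ₗ[ℝ] _)
    (fun x hx => by simp [show x = 0 from hx])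

/-- Entrywise application of `f` sends every symmetric matrix with entries in `(-ρ, ρ)` and
exactly `k` negative eigenvalues to one with at most `l` negative eigenvalues. -/
def NegTransform (ρ : EReal) (k l : ℕ) (f : ℝ → ℝ) : Prop :=
  ∀ n : ℕ, k ≤ n → ∀ A : Matrix (Fin n) (Fin n) ℝ,
    A.IsSymm → (∀ i j, memI ρ (A i j)) → negEigCount A = k →
      ((A.map f).IsSymm ∧ negEigCount (A.map f) ≤ l)

lemma NegTransform.finrank_le {ρ : EReal} {k l : ℕ} {f : ℝ → ℝ} (H : NegTransform ρ k l f)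
    {ι V U W : Type*} [Fintype ι] [AddCommGroup V] [Module ℝ V] [AddCommGroup U] [Module ℝ U]
    [Module.Finite ℝ U] [AddCommGroup W] [Module ℝ W]
    {A : Matrix ι ι ℝ} (hA : A.IsSymm) (hI : ∀ i j, memI ρ (A i j))
    (T : V →ₗ[ℝ] (ι → ℝ)) (hT : ∀ v, v ≠ 0 → T v ⬝ᵥ A *ᵥ T v < 0)
    (hV : Module.finrank ℝ V = k)
    (φ : (ι → ℝ) →ₗ[ℝ] U) (hφ : ∀ x, φ x = 0 → 0 ≤ x ⬝ᵥ A *ᵥ x)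
    (hU : Module.finrank ℝ U = k)
    (S : W →ₗ[ℝ] (ι → ℝ)) (hS : ∀ v, v ≠ 0 → S v ⬝ᵥ A.map f *ᵥ S v < 0) :
    Module.finrank ℝ W ≤ l := by
  classical
  let e := Fintype.equivFin ι
  have key : ∀ (B : Matrix ι ι ℝ) (x : Fin (Fintype.card ι) → ℝ),
      x ⬝ᵥ B.submatrix e.symm e.symm *ᵥ x = (x ∘ e) ⬝ᵥ B *ᵥ (x ∘ e) := by
    intro B x
    rw [submatrix_mulVec_equiv, Equiv.symm_symm, dotProduct_comp_equiv_symm]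
  have key' : ∀ (B : Matrix ι ι ℝ) (x : ι → ℝ),
      (x ∘ e.symm) ⬝ᵥ B.submatrix e.symm e.symm *ᵥ (x ∘ e.symm) = x ⬝ᵥ B *ᵥ x := by
    intro B x
    rw [key]; simp [Function.comp_assoc]
  have hA' : (A.submatrix e.symm e.symm).IsSymm := hA.submatrix _
  have hneg : negEigCount (A.submatrix e.symm e.symm) = k := by
    apply le_antisymm
    · rw [← hU]
      refine negEigCount_le_finrank hA' (φ ∘ₗ LinearMap.funLeft ℝ ℝ e) fun x hx => ?_
      rw [key]
      exact hφ _ hx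
    · rw [← hV]
      refine finrank_le_negEigCount hA' (LinearMap.funLeft ℝ ℝ e.symm ∘ₗ T) fun v hv => ?_
      exact (key' A (T v)).trans_lt (hT v hv)
  obtain ⟨h1, h2⟩ := H (Fintype.card ι)
    (by simpa [hneg] using negEigCount_le_card hA') _ hA' (fun i j => hI _ _) hneg
  refine le_trans (finrank_le_negEigCount h1 (LinearMap.funLeft ℝ ℝ e.symm ∘ₗ S)
    fun v hv => ?_) h2
  exact (key' (A.map f) (S v)).trans_lt (hS v hv)

lemma form_affine {ι : Type*} [Fintype ι] {A B : Matrix ι ι ℝ} {c d : ℝ}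
    (h : ∀ i j, B i j = d + c * A i j) (x : ι → ℝ) :
    x ⬝ᵥ B *ᵥ x = d * (∑ i, x i) ^ 2 + c * (x ⬝ᵥ A *ᵥ x) := by
  simp only [dotProduct, mulVec, h, sq, Finset.mul_sum, Finset.sum_mul, ← Finset.sum_add_distrib]
  exact Finset.sum_congr rfl fun i _ => Finset.sum_congr rfl fun j _ => by ring

/-- The direct sum of `k` copies of `M` and a zero. -/
def copiesWithZero {κ : Type*} (k : ℕ) (M : Matrix κ κ ℝ) :
    Matrix (Option (Fin k × κ)) (Option (Fin k × κ)) ℝ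
  | some (i, a), some (j, b) => if i = j then M a b else 0
  | _, _ => 0

lemma copiesWithZero_isSymm {κ : Type*} (k : ℕ) {M : Matrix κ κ ℝ} (hM : M.IsSymm) :
    (copiesWithZero k M).IsSymm := by
  ext (_ | ⟨i, a⟩) (_ | ⟨j, b⟩) <;> simp [copiesWithZero, eq_comm, hM.apply]

lemma form_map_copiesWithZero {κ : Type*} [Fintype κ] (k : ℕ) (M : Matrix κ κ ℝ) (f : ℝ → ℝ)
    (x : Option (Fin k × κ) → ℝ) :
    x ⬝ᵥ (copiesWithZero k M).map f *ᵥ x =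
      (∑ i, (fun a => x (some (i, a))) ⬝ᵥ M.map (fun t => f t - f 0) *ᵥ
        fun a => x (some (i, a))) + f 0 * (∑ p, x p) ^ 2 := by
  have h2 : x ⬝ᵥ (copiesWithZero k M).map f *ᵥ x =
      f 0 * (∑ p, x p) ^ 2 + 1 * (x ⬝ᵥ (copiesWithZero k M).map (fun t => f t - f 0) *ᵥ x) :=
    form_affine (fun p q => by simp) x
  rw [h2, add_comm, one_mul]
  congr 1
  simp only [dotProduct, mulVec, Fintype.sum_option, Fintype.sum_prod_type]
  simp [copiesWithZero, apply_ite f, ite_sub, ite_mul, Finset.sum_ite_eq]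

lemma form_copiesWithZero {κ : Type*} [Fintype κ] (k : ℕ) (M : Matrix κ κ ℝ)
    (x : Option (Fin k × κ) → ℝ) :
    x ⬝ᵥ copiesWithZero k M *ᵥ x =
      ∑ i, (fun a => x (some (i, a))) ⬝ᵥ M *ᵥ fun a => x (some (i, a)) := by
  simpa [show (fun t : ℝ => t) = id from rfl] using form_map_copiesWithZero k M id x

/-- Concatenate `k` vectors and append the coordinate that makes the total sum vanish. -/
def balance {κ : Type*} [Fintype κ] (k : ℕ) :
    (Fin k → κ → ℝ) →ₗ[ℝ] (Option (Fin k × κ) → ℝ) where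
  toFun y
    | some (i, a) => y i a
    | none => -∑ i, ∑ a, y i a
  map_add' y z := by
    ext (_ | ⟨i, a⟩) <;> simp [Finset.sum_add_distrib]; ring
  map_smul' c y := by
    ext (_ | ⟨i, a⟩) <;> simp [Finset.mul_sum]

lemma form_balance_neg {κ V : Type*} [Fintype κ] [AddCommGroup V] [Module ℝ V] (k : ℕ)
    (M : Matrix κ κ ℝ) (f : ℝ → ℝ) (T : V →ₗ[ℝ] (κ → ℝ))
    (hT : ∀ v, v ≠ 0 → T v ⬝ᵥ M.map (fun t => f t - f 0) *ᵥ T v < 0)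
    (w : Fin k → V) (hw : w ≠ 0) :
    (balance k ∘ₗ T.compLeft (Fin k)) w ⬝ᵥ (copiesWithZero k M).map f *ᵥ
      (balance k ∘ₗ T.compLeft (Fin k)) w < 0 := by
  have hsum : ∑ p, (balance k ∘ₗ T.compLeft (Fin k)) w p = 0 := by
    simp [Fintype.sum_option, Fintype.sum_prod_type, balance]
  rw [form_map_copiesWithZero, hsum]
  obtain ⟨i, hi⟩ := Function.ne_iff.mp hw
  have hle : ∀ j, T (w j) ⬝ᵥ M.map (fun t => f t - f 0) *ᵥ T (w j) ≤ 0 := by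
    intro j
    by_cases hj : w j = 0
    · simp [hj]
    · exact (hT _ hj).le
  have : ∑ j, T (w j) ⬝ᵥ M.map (fun t => f t - f 0) *ᵥ T (w j) < 0 :=
    Finset.sum_neg' (fun j _ => hle j) ⟨i, Finset.mem_univ _, hT _ hi⟩
  simpa [balance] using this

/-- Collect the values of a functional on each of the `k` blocks. -/
def blockFunctional {κ : Type*} (k : ℕ) (φ : (κ → ℝ) →ₗ[ℝ] ℝ) :
    (Option (Fin k × κ) → ℝ) →ₗ[ℝ] (Fin k → ℝ) :=
  LinearMap.pi fun i => φ ∘ₗ LinearMap.funLeft ℝ ℝ fun a => some (i, a)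

lemma form_copiesWithZero_nonneg {κ : Type*} [Fintype κ] (k : ℕ) {M : Matrix κ κ ℝ}
    {φ : (κ → ℝ) →ₗ[ℝ] ℝ} (hφ : ∀ x, φ x = 0 → 0 ≤ x ⬝ᵥ M *ᵥ x)
    (x : Option (Fin k × κ) → ℝ) (hx : blockFunctional k φ x = 0) :
    0 ≤ x ⬝ᵥ copiesWithZero k M *ᵥ x := by
  rw [form_copiesWithZero]
  exact Finset.sum_nonneg fun i _ => hφ _ (congrFun hx i)

lemma memI_copiesWithZero {κ : Type*} {ρ : EReal} (h0 : memI ρ 0) (k : ℕ) {M : Matrix κ κ ℝ}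
    (hI : ∀ a b, memI ρ (M a b)) (p q) : memI ρ (copiesWithZero k M p q) := by
  rcases p with _ | ⟨i, a⟩ <;> rcases q with _ | ⟨j, b⟩ <;> simp only [copiesWithZero]
  · exact h0
  · exact h0
  · exact h0
  · split_ifs
    exacts [hI a b, h0]

lemma form_copiesWithZero_neg {κ : Type*} [Fintype κ] (k : ℕ) {M : Matrix κ κ ℝ}
    {v : κ → ℝ} (hv : v ⬝ᵥ M *ᵥ v < 0) (w : Fin k → ℝ) (hw : w ≠ 0) :
    (balance k ∘ₗ (LinearMap.toSpanSingleton ℝ _ v).compLeft (Fin k)) w ⬝ᵥ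
      copiesWithZero k M *ᵥ
        (balance k ∘ₗ (LinearMap.toSpanSingleton ℝ _ v).compLeft (Fin k)) w < 0 := by
  simpa using form_balance_neg k M id (LinearMap.toSpanSingleton ℝ _ v)
    (fun c hc => by
      have : 0 < c * c := mul_self_pos.mpr hc
      simpa [mulVec_smul, ← mul_assoc] using mul_neg_of_pos_of_neg this hv) w hw

lemma NegTransform.mul_finrank_le {ρ : EReal} {k l : ℕ} {f : ℝ → ℝ} (H : NegTransform ρ k l f)
    (h0 : memI ρ 0) {κ V : Type*} [Fintype κ] [AddCommGroup V] [Module ℝ V] [Module.Finite ℝ V]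
    {M : Matrix κ κ ℝ} (hM : M.IsSymm) (hI : ∀ a b, memI ρ (M a b))
    {v : κ → ℝ} (hv : v ⬝ᵥ M *ᵥ v < 0)
    (φ : (κ → ℝ) →ₗ[ℝ] ℝ) (hφ : ∀ x, φ x = 0 → 0 ≤ x ⬝ᵥ M *ᵥ x)
    (T : V →ₗ[ℝ] (κ → ℝ))
    (hT : ∀ v, v ≠ 0 → T v ⬝ᵥ M.map (fun t => f t - f 0) *ᵥ T v < 0) :
    k * Module.finrank ℝ V ≤ l := by
  have := H.finrank_le (copiesWithZero_isSymm k hM) (memI_copiesWithZero h0 k hI)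
    _ (form_copiesWithZero_neg k hv) (by simp)
    (blockFunctional k φ) (form_copiesWithZero_nonneg k hφ) (by simp)
    _ (form_balance_neg k M f T hT)
  simpa [Module.finrank_pi_fintype] using this

/-- The plane in `ℝ ^ 3` detecting a failure of convexity. -/
noncomputable def convexityPlane (b p q : ℝ) : (ℝ × ℝ) →ₗ[ℝ] (Fin 3 → ℝ) where
  toFun w := ![-((p + 1) * w.1 + 2 * (p - q) * w.2) / (2 * b), w.1 + w.2, -w.2]
  map_add' w z := by
    ext i; fin_cases i <;> simp <;> ring
  map_smul' c w := by
    ext i; fin_cases i <;> simp <;> ring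

/-- The plane in `ℝ ^ 4` detecting that `[x, y; y, x]` is invertible. -/
def invertibilityPlane (x y : ℝ) : (ℝ × ℝ) →ₗ[ℝ] (Fin 4 → ℝ) where
  toFun w := ![w.1, w.2, -(x * w.1 + y * w.2), -(y * w.1 + x * w.2)]
  map_add' w z := by
    ext i; fin_cases i <;> simp <;> ring
  map_smul' c w := by
    ext i; fin_cases i <;> simp <;> ring

lemma NegTransform.convex_ineq {ρ : EReal} {k l : ℕ} {f : ℝ → ℝ} (H : NegTransform ρ k l f)
    (h0 : memI ρ 0) (hkl : l < k * 2) {b p q r : ℝ} (hb : memI ρ b) (hp : memI ρ p)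
    (hq : memI ρ q) (hr : memI ρ r) (hfb : f b - f 0 ≠ 0) (hpqr : 2 * q ≤ p + r) :
    2 * (f q - f 0) ≤ (f p - f 0) + (f r - f 0) := by
  by_contra! hlt
  have hb0 : b ≠ 0 := by rintro rfl; simp at hfb
  have form : ∀ (b p q r : ℝ) (x : Fin 3 → ℝ), x ⬝ᵥ !![0, b, b; b, p, q; b, q, r] *ᵥ x =
      2 * b * x 0 * (x 1 + x 2) + p * x 1 ^ 2 + 2 * q * x 1 * x 2 + r * x 2 ^ 2 := by
    intro b p q r x
    simp [dotProduct, mulVec, Fin.sum_univ_three]; ring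
  have hM : (!![0, b, b; b, p, q; b, q, r] : Matrix (Fin 3) (Fin 3) ℝ).IsSymm := by
    ext i j; fin_cases i <;> fin_cases j <;> rfl
  let φ : (Fin 3 → ℝ) →ₗ[ℝ] ℝ :=
    LinearMap.proj (R := ℝ) (φ := fun _ => ℝ) 1 + LinearMap.proj (R := ℝ) (φ := fun _ => ℝ) 2
  have hφ : ∀ x, φ x = 0 → 0 ≤ x ⬝ᵥ !![0, b, b; b, p, q; b, q, r] *ᵥ x := by
    intro x hx
    have h2 : x 2 = -x 1 := by
      have : x 1 + x 2 = 0 := hx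
      linarith
    rw [form, h2]
    nlinarith [mul_nonneg (sub_nonneg.mpr hpqr) (sq_nonneg (x 1))]
  have := H.mul_finrank_le h0 hM
    (fun i j => by fin_cases i <;> fin_cases j <;> assumption)
    (v := ![-(p + 1) / (2 * b), 1, 0])
    (by rw [form]; simp; field_simp; linarith)
    φ hφ
    (convexityPlane (f b - f 0) (f p - f 0) (f q - f 0))
    (fun w hw => by
      have hmap : (!![0, b, b; b, p, q; b, q, r] : Matrix (Fin 3) (Fin 3) ℝ).map
          (fun t => f t - f 0) = !![0, f b - f 0, f b - f 0; f b - f 0, f p - f 0, f q - f 0;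
            f b - f 0, f q - f 0, f r - f 0] := by
        ext i j; fin_cases i <;> fin_cases j <;> simp
      rw [hmap, form]
      have hval : ∀ β P Q R : ℝ, β ≠ 0 → 2 * β * convexityPlane β P Q w 0 *
          (convexityPlane β P Q w 1 + convexityPlane β P Q w 2) +
          P * convexityPlane β P Q w 1 ^ 2 +
          2 * Q * convexityPlane β P Q w 1 * convexityPlane β P Q w 2 +
          R * convexityPlane β P Q w 2 ^ 2 = (P + R - 2 * Q) * w.2 ^ 2 - w.1 ^ 2 := by
        intro β P Q R hβ
        simp [convexityPlane]; field_simp; ring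
      rw [hval _ _ _ _ hfb]
      by_cases h2 : w.2 = 0
      · have h1 : w.1 ≠ 0 := fun h1 => hw (Prod.ext h1 h2)
        have := pow_pos (abs_pos.mpr h1) 2
        rw [sq_abs] at this
        rw [h2]; linarith
      · have : 0 < w.2 ^ 2 := by positivity
        nlinarith [mul_pos (sub_pos.mpr hlt) this, sq_nonneg w.1])
  simp at this
  omega

lemma NegTransform.sq_eq {ρ : EReal} {k l : ℕ} {f : ℝ → ℝ} (H : NegTransform ρ k l f)
    (h0 : memI ρ 0) (hkl : l < k * 2) {x : ℝ} (hx : memI ρ x) (hx' : memI ρ (-x)) :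
    (f x - f 0) ^ 2 = (f (-x) - f 0) ^ 2 := by
  by_contra hne
  have hx0 : x ≠ 0 := by rintro rfl; simp at hne
  have form : ∀ (x y : ℝ) (z : Fin 4 → ℝ),
      z ⬝ᵥ !![0, 0, x, y; 0, 0, y, x; x, y, 0, 0; y, x, 0, 0] *ᵥ z =
      2 * (x * z 0 * z 2 + y * z 0 * z 3 + y * z 1 * z 2 + x * z 1 * z 3) := by
    intro x y z
    simp [dotProduct, mulVec, Fin.sum_univ_four]; ring
  have hM : (!![0, 0, x, -x; 0, 0, -x, x; x, -x, 0, 0; -x, x, 0, 0] :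
      Matrix (Fin 4) (Fin 4) ℝ).IsSymm := by
    ext i j; fin_cases i <;> fin_cases j <;> rfl
  let φ : (Fin 4 → ℝ) →ₗ[ℝ] ℝ :=
    LinearMap.proj (R := ℝ) (φ := fun _ => ℝ) 0 - LinearMap.proj (R := ℝ) (φ := fun _ => ℝ) 1
  have hφ : ∀ z, φ z = 0 →
      0 ≤ z ⬝ᵥ !![0, 0, x, -x; 0, 0, -x, x; x, -x, 0, 0; -x, x, 0, 0] *ᵥ z := by
    intro z hz
    have h2 : z 0 = z 1 := by
      have : z 0 - z 1 = 0 := hz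
      linarith
    rw [form, h2]
    exact le_of_eq (by ring)
  have := H.mul_finrank_le h0 hM
    (fun i j => by fin_cases i <;> fin_cases j <;> assumption)
    (v := ![1, 0, -x, 0])
    (by rw [form]; simp; positivity)
    φ hφ
    (invertibilityPlane (f x - f 0) (f (-x) - f 0))
    (fun w hw => by
      have hmap : (!![0, 0, x, -x; 0, 0, -x, x; x, -x, 0, 0; -x, x, 0, 0] :
          Matrix (Fin 4) (Fin 4) ℝ).map (fun t => f t - f 0) =
          !![0, 0, f x - f 0, f (-x) - f 0; 0, 0, f (-x) - f 0, f x - f 0;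
            f x - f 0, f (-x) - f 0, 0, 0; f (-x) - f 0, f x - f 0, 0, 0] := by
        ext i j; fin_cases i <;> fin_cases j <;> simp
      rw [hmap, form]
      generalize f x - f 0 = X at *
      generalize f (-x) - f 0 = Y at *
      by_contra! hge
      have h1 : 2 * ((X * w.1 + Y * w.2) ^ 2 + (Y * w.1 + X * w.2) ^ 2) ≤ 0 := by
        simp [invertibilityPlane] at hge
        nlinarith
      have e1 : X * w.1 + Y * w.2 = 0 := by
        nlinarith [sq_nonneg (X * w.1 + Y * w.2), sq_nonneg (Y * w.1 + X * w.2)]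
      have e2 : Y * w.1 + X * w.2 = 0 := by
        nlinarith [sq_nonneg (X * w.1 + Y * w.2), sq_nonneg (Y * w.1 + X * w.2)]
      have hd : X ^ 2 - Y ^ 2 ≠ 0 := sub_ne_zero.mpr hne
      have f1 : (X ^ 2 - Y ^ 2) * w.1 = 0 := by linear_combination X * e1 - Y * e2
      have f2 : (X ^ 2 - Y ^ 2) * w.2 = 0 := by linear_combination X * e2 - Y * e1
      exact hw (Prod.ext ((mul_eq_zero.mp f1).resolve_left hd)
        ((mul_eq_zero.mp f2).resolve_left hd)))
  simp at this
  omega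

lemma memI_zero {ρ : EReal} (hρ : 0 < ρ) : memI ρ 0 :=
  ⟨by simpa using EReal.neg_lt_neg_iff.mpr hρ, by simpa using hρ⟩

lemma memI.of_abs_le {ρ : EReal} {x y : ℝ} (hx : memI ρ x) (h : |y| ≤ |x|) : memI ρ y := by
  have hx' : ((|x| : ℝ) : EReal) < ρ := by
    rcases abs_cases x with ⟨h, -⟩ | ⟨h, -⟩ <;> rw [h]
    · exact hx.2
    · rw [EReal.coe_neg]; exact EReal.neg_lt_comm.mp hx.1
  have hy : ((|y| : ℝ) : EReal) < ρ := (EReal.coe_le_coe_iff.mpr h).trans_lt hx'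
  constructor
  · refine EReal.neg_lt_comm.mp (lt_of_le_of_lt ?_ hy)
    rw [← EReal.coe_neg]
    exact EReal.coe_le_coe_iff.mpr (neg_le_abs y)
  · exact (EReal.coe_le_coe_iff.mpr (le_abs_self y)).trans_lt hy

lemma exists_pos_memI {ρ : EReal} (hρ : 0 < ρ) : ∃ ε : ℝ, 0 < ε ∧ memI ρ ε := by
  obtain ⟨ε, h1, h2⟩ := EReal.lt_iff_exists_real_btwn.mp hρ
  have h1' : 0 < ε := by exact_mod_cast h1
  refine ⟨ε, h1', lt_trans ?_ h1, h2⟩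
  simpa using EReal.neg_lt_neg_iff.mpr hρ

/-- A monotone odd solution of Jensen's equation on a symmetric interval is linear. -/
lemma exists_linear_of_jensen {ρ : EReal} (hρ : 0 < ρ) {g : ℝ → ℝ} (hg0 : g 0 = 0)
    (hodd : ∀ x, memI ρ x → g (-x) = -g x)
    (hineq : ∀ p q r, memI ρ p → memI ρ q → memI ρ r → 2 * q ≤ p + r → 2 * g q ≤ g p + g r) :
    ∃ c : ℝ, 0 ≤ c ∧ ∀ x, memI ρ x → g x = c * x := by
  have mono : ∀ x y, memI ρ x → memI ρ y → x ≤ y → g x ≤ g y := fun x y hx hy hxy => by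
    linarith [hineq y x y hy hx hy (by linarith)]
  have hneg : ∀ x, memI ρ x → memI ρ (-x) := fun x hx => hx.of_abs_le (abs_neg x).le
  have jensen : ∀ p q r, memI ρ p → memI ρ q → memI ρ r → 2 * q = p + r →
      2 * g q = g p + g r := by
    intro p q r hp hq hr h
    have h1 := hineq p q r hp hq hr h.le
    have h2 := hineq (-p) (-q) (-r) (hneg p hp) (hneg q hq) (hneg r hr) (by linarith)
    rw [hodd p hp, hodd q hq, hodd r hr] at h2
    linarith
  have hmul : ∀ (y : ℝ) (m : ℕ), 0 ≤ y → memI ρ (m * y) → g (m * y) = m * g y := by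
    intro y m hy
    induction m using Nat.twoStepInduction with
    | zero => simp [hg0]
    | one => simp
    | more m ih1 ih2 =>
      intro h
      have le_mem : ∀ t : ℝ, 0 ≤ t → t ≤ m + 2 → memI ρ (t * y) := fun t ht htm => by
        refine h.of_abs_le ?_
        rw [abs_of_nonneg (by positivity), abs_of_nonneg (by positivity)]
        push_cast
        exact mul_le_mul_of_nonneg_right htm hy
      have hm1 : memI ρ (((m + 1 : ℕ) : ℝ) * y) :=
        le_mem _ (by positivity) (by push_cast; linarith)
      have hm : memI ρ ((m : ℝ) * y) := le_mem _ (by positivity) (by linarith)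
      have := jensen _ _ _ hm hm1 h (by push_cast; ring)
      rw [ih1 hm, ih2 hm1] at this
      push_cast at this ⊢
      linarith
  have cross : ∀ x y, 0 < x → 0 < y → memI ρ x → memI ρ y → g x * y ≤ g y * x := by
    intro x y hx hy hxI hyI
    have hgx : 0 ≤ g x := hg0 ▸ mono 0 x (memI_zero hρ) hxI hx.le
    by_contra! hlt
    obtain ⟨n, hn⟩ := exists_nat_gt (g x * x / (g x * y - g y * x))
    have hn0 : (0 : ℝ) < n := lt_of_le_of_lt
      (div_nonneg (by positivity) (by linarith)) hn
    rw [div_lt_iff₀ (by linarith)] at hn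
    have hxn : (n : ℝ) * (x / n) = x := by field_simp
    have e1 := hmul (x / n) n (by positivity) (by rwa [hxn])
    rw [hxn] at e1
    set m := ⌊y * n / x⌋₊
    have hm1 : (m : ℝ) ≤ y * n / x := Nat.floor_le (by positivity)
    have hm2 : y * n / x < m + 1 := Nat.lt_floor_add_one _
    rw [le_div_iff₀ hx] at hm1
    rw [div_lt_iff₀ hx] at hm2
    have hle : (m : ℝ) * (x / n) ≤ y := by
      rw [← mul_div_assoc, div_le_iff₀ hn0]; exact hm1
    have hmI : memI ρ ((m : ℝ) * (x / n)) := hyI.of_abs_le (by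
      rwa [abs_of_nonneg (by positivity), abs_of_pos hy])
    have e2 := hmul (x / n) m (by positivity) hmI
    have h3 := mono _ _ hmI hyI hle
    rw [e2] at h3
    have h4 : (m : ℝ) * g x ≤ n * g y := by
      rw [e1]; nlinarith
    nlinarith
  obtain ⟨ε, hε, hεI⟩ := exists_pos_memI hρ
  have hpos : ∀ x, 0 < x → memI ρ x → g x = g ε / ε * x := by
    intro x hx hxI
    have := le_antisymm (cross x ε hx hε hxI hεI) (cross ε x hε hx hεI hxI)
    field_simp
    linarith
  refine ⟨g ε / ε, div_nonneg (hg0 ▸ mono 0 ε (memI_zero hρ) hεI hε.le) hε.le, fun x hx => ?_⟩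
  rcases lt_trichotomy x 0 with h | rfl | h
  · have h1 := hpos (-x) (by linarith) (hneg x hx)
    rw [hodd x hx] at h1
    linarith
  · simp [hg0]
  · exact hpos x h hx

/-- The sum of the coordinates as a linear functional. -/
def coordSum (ι : Type*) [Fintype ι] : (ι → ℝ) →ₗ[ℝ] ℝ := ∑ i, LinearMap.proj i

lemma coordSum_apply {ι : Type*} [Fintype ι] (x : ι → ℝ) : coordSum ι x = ∑ i, x i := by
  simp [coordSum]

lemma negTransform_of_const {ρ : EReal} {k l : ℕ} {f : ℝ → ℝ} (hl : 1 ≤ l) {d : ℝ}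
    (hf : ∀ x, memI ρ x → f x = d) : NegTransform ρ k l f := by
  intro n _ A hA hI _
  refine ⟨hA.map f, le_trans (negEigCount_le_finrank (hA.map f) (coordSum _) fun x hx => ?_)
    (by simpa using hl)⟩
  rw [coordSum_apply] at hx
  rw [form_affine (A := A) (c := 0) (d := d) (fun i j => by simp [hf _ (hI i j)]), hx]
  simp

lemma negTransform_of_linear {ρ : EReal} {k l : ℕ} {f : ℝ → ℝ} (hkl : k ≤ l) {c : ℝ}
    (hc : 0 < c) (hf : ∀ x, memI ρ x → f x = f 0 + c * x) (hf0 : l = k → 0 ≤ f 0) :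
    NegTransform ρ k l f := by
  intro n _ A hA hI hneg
  obtain ⟨φ, hφ⟩ := exists_nonneg_on_ker hA
  have form := form_affine (A := A) (B := A.map f) (c := c) (d := f 0)
    (fun i j => by simp [hf _ (hI i j)])
  refine ⟨hA.map f, ?_⟩
  by_cases h : 0 ≤ f 0
  · refine le_trans (negEigCount_le_finrank (hA.map f) φ fun x hx => ?_) (by simpa [hneg])
    rw [form]
    exact add_nonneg (mul_nonneg h (sq_nonneg _)) (mul_nonneg hc.le (hφ x hx))
  · have hlt : k < l := lt_of_le_of_ne hkl fun e => h (hf0 e.symm)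
    refine le_trans (negEigCount_le_finrank (hA.map f) (φ.prod (coordSum _)) fun x hx => ?_)
      (by simpa [hneg])
    obtain ⟨h1, h2⟩ := Prod.ext_iff.mp hx
    have h2 : ∑ i, x i = 0 := by rw [← coordSum_apply]; exact h2
    rw [form, h2]
    simpa using mul_nonneg hc.le (hφ x h1)

lemma NegTransform.exists_linear {ρ : EReal} (hρ : 0 < ρ) {k l : ℕ} {f : ℝ → ℝ}
    (H : NegTransform ρ k l f) (hkl : l < k * 2) (hf : ¬ ∃ d, ∀ x, memI ρ x → f x = d) :
    ∃ c : ℝ, 0 < c ∧ ∀ x, memI ρ x → f x = f 0 + c * x := by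
  have h0 := memI_zero hρ
  push Not at hf
  obtain ⟨b, hb, hfb⟩ := hf (f 0)
  have hfb' := sub_ne_zero.mpr hfb
  have hineq := fun p q r (hp : memI ρ p) (hq : memI ρ q) (hr : memI ρ r) =>
    H.convex_ineq h0 hkl hb hp hq hr hfb'
  have hodd : ∀ x, memI ρ x → f (-x) - f 0 = -(f x - f 0) := by
    intro x hx
    have hx' : memI ρ (-x) := hx.of_abs_le (abs_neg x).le
    rcases sq_eq_sq_iff_eq_or_eq_neg.mp (H.sq_eq h0 hkl hx hx') with h | h
    · rcases le_total 0 x with hx0 | hx0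
      · have h1 := hineq 0 (-x) 0 h0 hx' h0 (by linarith)
        have h2 := hineq x 0 x hx h0 hx (by linarith)
        linarith
      · have h1 := hineq 0 x 0 h0 hx h0 (by linarith)
        have h2 := hineq (-x) 0 (-x) hx' h0 hx' (by linarith)
        linarith
    · linarith
  obtain ⟨c, hc, hlin⟩ := exists_linear_of_jensen hρ (sub_self (f 0)) hodd hineq
  refine ⟨c, lt_of_le_of_ne hc ?_, fun x hx => by linarith [hlin x hx]⟩
  rintro rfl
  exact hfb' (by simpa using hlin b hb)

lemma NegTransform.le_and_nonneg {ρ : EReal} (hρ : 0 < ρ) {k l : ℕ} {f : ℝ → ℝ}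
    (H : NegTransform ρ k l f) {c : ℝ} (hc : 0 < c)
    (hf : ∀ x, memI ρ x → f x = f 0 + c * x) : k ≤ l ∧ (l = k → 0 ≤ f 0) := by
  have h0 := memI_zero hρ
  obtain ⟨ε, hε, hεI⟩ := exists_pos_memI hρ
  have hεI' : memI ρ (-ε) := hεI.of_abs_le (abs_neg ε).le
  have hfε : f (-ε) - f 0 = -(c * ε) := by rw [hf _ hεI']; ring
  have hcε : 0 < c * ε := mul_pos hc hε
  let M : Matrix Unit Unit ℝ := fun _ _ => -ε
  have hM : M.IsSymm := rfl
  have hv : (fun _ => 1 : Unit → ℝ) ⬝ᵥ M *ᵥ (fun _ => 1) < 0 := by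
    simpa [M, dotProduct, mulVec] using hε
  have hφ : ∀ x : Unit → ℝ, coordSum Unit x = 0 → 0 ≤ x ⬝ᵥ M *ᵥ x := by
    intro x hx
    have hx0 : x () = 0 := by simpa [coordSum_apply] using hx
    simp [dotProduct, mulVec, hx0]
  have hform : ∀ x : Unit → ℝ,
      x ⬝ᵥ M.map (fun t => f t - f 0) *ᵥ x = -(c * ε * x () ^ 2) := by
    intro x
    have : x ⬝ᵥ M.map (fun t => f t - f 0) *ᵥ x = x () * ((f (-ε) - f 0) * x ()) := by
      simp only [dotProduct, mulVec, Finset.univ_unique, Finset.sum_singleton]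
      rfl
    rw [this, hfε]
    ring
  constructor
  · have := H.mul_finrank_le h0 hM (fun _ _ => hεI') hv (coordSum Unit) hφ
      (LinearMap.id : (Unit → ℝ) →ₗ[ℝ] _) (fun v hne => by
        have hv0 : v () ≠ 0 := fun h => hne (funext fun _ => h)
        rw [LinearMap.id_apply, hform, neg_lt_zero]
        positivity)
    simpa using this
  · rintro rfl
    by_contra! hneg
    have := H.finrank_le (copiesWithZero_isSymm l hM)
      (memI_copiesWithZero h0 l fun _ _ => hεI')
      _ (form_copiesWithZero_neg l hv) (by simp)
      (blockFunctional l (coordSum Unit)) (form_copiesWithZero_nonneg l hφ) (by simp)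
      (LinearMap.id : (Option (Fin l × Unit) → ℝ) →ₗ[ℝ] _) (fun x hx => by
        rw [LinearMap.id_apply, form_map_copiesWithZero]
        simp only [hform]
        by_contra! hge
        have hle : ∀ i : Fin l, -(c * ε * x (some (i, ())) ^ 2) ≤ 0 := fun i => by
          rw [neg_nonpos]; positivity
        have h1 := Finset.sum_nonpos fun i (_ : i ∈ Finset.univ) => hle i
        have h2 : f 0 * (∑ p, x p) ^ 2 ≤ 0 :=
          mul_nonpos_of_nonpos_of_nonneg hneg.le (sq_nonneg _)
        have h3 := (Finset.sum_eq_zero_iff_of_nonpos fun i (_ : i ∈ Finset.univ) => hle i).mp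
          (by linarith)
        have hx1 : ∀ i, x (some (i, ())) = 0 := fun i => by
          simpa [hcε.ne', hc.ne', hε.ne'] using h3 i (Finset.mem_univ _)
        have h4 : f 0 * (∑ p, x p) ^ 2 = 0 := by linarith
        have hx2 : x none = 0 := by
          simpa [hneg.ne, Fintype.sum_option, Fintype.sum_prod_type, hx1] using h4
        exact hx (funext fun
          | none => hx2
          | some (i, ()) => hx1 i))
    simp at this

/-- Theorem A: for positive integers `k`, `l` with `l = 1` if `k = 1` and `l ≤ 2k - 2`
if `k ≥ 2`, the transform `f[-]` sends `S_n^(k)((-ρ,ρ))` into the matrices with at most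
`l` negative eigenvalues for all `n ≥ k` if and only if exactly one of the following holds:
(a) `f` is constant; (b) `l ≥ k` and `f(x) = f(0) + c x` with `c > 0`, where moreover
`f(0) ≥ 0` if `l = k`. -/
theorem strongest_preserver_iff (ρ : EReal) (hρ : 0 < ρ) (k l : ℕ)
    (hk : 1 ≤ k) (hl : 1 ≤ l)
    (hkl1 : k = 1 → l = 1) (hkl2 : 2 ≤ k → l ≤ 2 * k - 2) (f : ℝ → ℝ) :
    (∀ n : ℕ, k ≤ n → ∀ A : Matrix (Fin n) (Fin n) ℝ,
        A.IsSymm → (∀ i j, memI ρ (A i j)) → negEigCount A = k →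
        ((A.map f).IsSymm ∧ negEigCount (A.map f) ≤ l)) ↔
    Xor' (∃ d : ℝ, ∀ x : ℝ, memI ρ x → f x = d)
         (k ≤ l ∧ (∃ c : ℝ, 0 < c ∧ ∀ x : ℝ, memI ρ x → f x = f 0 + c * x) ∧
           (l = k → 0 ≤ f 0)) := by
  have hkl : l < k * 2 := by
    rcases hk.eq_or_lt with h | h
    · have := hkl1 h.symm
      omega
    · have := hkl2 h
      omega
  have hexcl : ∀ c : ℝ, 0 < c → (∀ x, memI ρ x → f x = f 0 + c * x) →
      ¬ ∃ d, ∀ x, memI ρ x → f x = d := by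
    rintro c hc hf ⟨d, hd⟩
    obtain ⟨ε, hε, hεI⟩ := exists_pos_memI hρ
    have h := hf ε hεI
    rw [hd ε hεI, hd 0 (memI_zero hρ)] at h
    linarith [mul_pos hc hε]
  constructor
  · intro H
    replace H : NegTransform ρ k l f := H
    by_cases hconst : ∃ d, ∀ x, memI ρ x → f x = d
    · exact Or.inl ⟨hconst, fun ⟨_, ⟨c, hc, hf⟩, _⟩ => hexcl c hc hf hconst⟩
    · obtain ⟨c, hc, hf⟩ := H.exists_linear hρ hkl hconst
      obtain ⟨h1, h2⟩ := H.le_and_nonneg hρ hc hf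
      exact Or.inr ⟨⟨h1, ⟨c, hc, hf⟩, h2⟩, hconst⟩
  · rintro (⟨⟨d, hd⟩, -⟩ | ⟨⟨h1, ⟨c, hc, hf⟩, h2⟩, -⟩)
    · exact negTransform_of_const hl hd
    · exact negTransform_of_linear h1 hc hf h2
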